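/- Let α, β be real numbers with -1 < β ≤ α < -1/2. For each k ∈ ℕ₀ let T_k : L_{(α,β)} → ℂ be the bounded linear functional T_k f = f̂_{(α,β)}(k). Then there exists a constant C′ > 0 such that the operator norm satisfies ‖T_k‖ ≥ C′ (k+1)^{-α-1/2} for all k ∈ ℕ₀. -/

import Mathlib

open MeasureTheory Filter Set

noncomputable section

/-- Generalized binomial coefficient `C(a, m) = Γ(a+1)/(Γ(m+1)Γ(a-m+1))`. -/
def genBinom (a : ℝ) (m : ℕ) : ℝ :=
  Real.Gamma (a + 1) / (Real.Gamma ((m : ℝ) + 1) * Real.Gamma (a - (m : ℝ) + 1))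

/-- The Jacobi polynomial `P_k^{(α,β)}(x)`. -/
def jacobiP (α β : ℝ) (k : ℕ) (x : ℝ) : ℝ :=
  ∑ s ∈ Finset.range (k + 1),
    genBinom ((k : ℝ) + α) (k - s) * genBinom ((k : ℝ) + β) s *
      ((x - 1) / 2) ^ s * ((x + 1) / 2) ^ (k - s)

/-- The normalized Jacobi polynomial `R_k^{(α,β)}(x) = P_k^{(α,β)}(x)/P_k^{(α,β)}(1)`. -/
def jacobiR (α β : ℝ) (k : ℕ) (x : ℝ) : ℝ := jacobiP α β k x / jacobiP α β k 1

/-- The Jacobi weight `(sin(θ/2))^{2α+1} (cos(θ/2))^{2β+1}`. -/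
def jacobiWeight (α β : ℝ) (θ : ℝ) : ℝ :=
  Real.sin (θ / 2) ^ (2 * α + 1) * Real.cos (θ / 2) ^ (2 * β + 1)

/-- `f ∈ L_{(α,β)}`: `f` is integrable on `[0,π]` against the Jacobi weight. -/
def MemJacobiL (α β : ℝ) (f : ℝ → ℝ) : Prop :=
  IntegrableOn (fun θ => f θ * jacobiWeight α β θ) (Ioc 0 Real.pi)

/-- The norm `‖f‖_{L_{(α,β)}}`. -/
def jacobiNorm (α β : ℝ) (f : ℝ → ℝ) : ℝ :=
  ∫ θ in Ioc (0 : ℝ) Real.pi, |f θ| * jacobiWeight α β θ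

/-- The `k`-th Fourier–Jacobi coefficient `f̂_{(α,β)}(k)`. -/
def fourierJacobi (α β : ℝ) (f : ℝ → ℝ) (k : ℕ) : ℝ :=
  ∫ θ in Ioc (0 : ℝ) Real.pi, f θ * jacobiR α β k (Real.cos θ) * jacobiWeight α β θ

end

/-- The operator norm of the functional `T_k f = f̂_{(α,β)}(k)` on `L_{(α,β)}`,
i.e. the supremum of `|f̂_{(α,β)}(k)|` over the unit ball. -/
noncomputable def jacobiCoeffOpNorm (α β : ℝ) (k : ℕ) : ℝ :=
  sSup {r : ℝ | ∃ f : ℝ → ℝ, MemJacobiL α β f ∧ jacobiNorm α β f ≤ 1 ∧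
    r = |fourierJacobi α β f k|}

lemma Ring.choose_succ_mul (r : ℝ) (m : ℕ) :
    Ring.choose r (m + 1) * ((m : ℝ) + 1) = Ring.choose r m * (r - m) := by
  have h : (m.factorial : ℝ) ≠ 0 := by exact_mod_cast m.factorial_ne_zero
  have h1 := Ring.descPochhammer_eq_factorial_smul_choose r m
  have h2 := Ring.descPochhammer_eq_factorial_smul_choose r (m + 1)
  rw [descPochhammer_succ_right, Polynomial.smeval_mul, h1] at h2
  simp [Polynomial.smeval_sub, Nat.factorial_succ, Polynomial.smeval_natCast] at h2
  apply mul_left_cancel₀ h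
  linarith

lemma genBinom_eq_choose (a : ℝ) (m : ℕ) (h : 0 < a - m + 1) :
    genBinom a m = Ring.choose a m := by
  induction m with
  | zero =>
    have : Real.Gamma (a + 1) ≠ 0 := (Real.Gamma_pos_of_pos (by simpa using h)).ne'
    simp [genBinom, this]
  | succ m ih =>
    push_cast at h
    have hpos : 0 < a - m := by linarith
    have hm : (0 : ℝ) < (m : ℝ) + 1 := by positivity
    have hΓ := (Real.Gamma_pos_of_pos hpos).ne'
    have hΓ' := (Real.Gamma_pos_of_pos hm).ne'
    have hchoose := Ring.choose_succ_mul a m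
    rw [← ih (by linarith), ← eq_div_iff hm.ne'] at hchoose
    rw [hchoose, genBinom, genBinom]
    push_cast
    rw [show a - ((m : ℝ) + 1) + 1 = a - m by ring, Real.Gamma_add_one hm.ne',
      Real.Gamma_add_one hpos.ne']
    field_simp

lemma genBinom_pos (a : ℝ) (m : ℕ) (h : 0 < a - m + 1) : 0 < genBinom a m := by
  have hm : (0 : ℝ) ≤ m := m.cast_nonneg
  have h1 := Real.Gamma_pos_of_pos h
  have h2 : 0 < Real.Gamma (a + 1) := Real.Gamma_pos_of_pos (by linarith)
  have h3 : 0 < Real.Gamma ((m : ℝ) + 1) := Real.Gamma_pos_of_pos (by positivity)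
  unfold genBinom
  positivity

lemma sum_genBinom_mul_genBinom (α β : ℝ) (hα : -1 < α) (hβ : -1 < β) (k : ℕ) :
    ∑ s ∈ Finset.range (k + 1), genBinom ((k : ℝ) + α) (k - s) * genBinom ((k : ℝ) + β) s =
      Ring.choose (2 * (k : ℝ) + (α + β)) k := by
  rw [show 2 * (k : ℝ) + (α + β) = (k + β) + (k + α) by ring,
    Ring.add_choose_eq k (Commute.all _ _), Finset.Nat.sum_antidiagonal_eq_sum_range_succ_mk]
  refine Finset.sum_congr rfl fun s hs => ?_
  have hs' : s ≤ k := Nat.lt_succ_iff.mp (Finset.mem_range.mp hs)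
  have hsr : (s : ℝ) ≤ k := by exact_mod_cast hs'
  have hs0 : (0 : ℝ) ≤ s := s.cast_nonneg
  rw [genBinom_eq_choose _ _ (by rw [Nat.cast_sub hs']; linarith),
    genBinom_eq_choose _ _ (by linarith), mul_comm]

lemma genBinom_add_le_rpow (α : ℝ) (hα : -1 < α) (hα0 : α ≤ 0) (k : ℕ) :
    genBinom ((k : ℝ) + α) k ≤ ((k : ℝ) + 1) ^ α := by
  induction k with
  | zero =>
    have : Real.Gamma (α + 1) ≠ 0 := (Real.Gamma_pos_of_pos (by linarith)).ne'
    simp [genBinom, this]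
  | succ k ih =>
    have hk : (0 : ℝ) < (k : ℝ) + 1 := by positivity
    have hka : 0 < (k : ℝ) + 1 + α := by linarith [k.cast_nonneg (α := ℝ)]
    have hrec : genBinom (((k + 1 : ℕ) : ℝ) + α) (k + 1) =
        genBinom ((k : ℝ) + α) k * (1 + α / (k + 1)) := by
      have h1 : 0 < Real.Gamma (α + 1) := Real.Gamma_pos_of_pos (by linarith)
      have h2 := Real.Gamma_pos_of_pos hk
      unfold genBinom
      push_cast
      rw [Real.Gamma_add_one hk.ne', Real.Gamma_add_one hka.ne',
        show (k : ℝ) + 1 + α - (k + 1) + 1 = α + 1 by ring,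
        show (k : ℝ) + α - k + 1 = α + 1 by ring, show (k : ℝ) + α + 1 = k + 1 + α by ring]
      field_simp
    have hbern : 1 + α / ((k : ℝ) + 1) ≤ (((k : ℝ) + 2) / (k + 1)) ^ α := by
      have hq : 0 < ((k : ℝ) + 2) / (k + 1) := by positivity
      rw [Real.rpow_def_of_pos hq]
      have hlog := Real.log_le_sub_one_of_pos hq
      have hq1 : ((k : ℝ) + 2) / (k + 1) - 1 = 1 / (k + 1) := by field_simp; ring
      rw [hq1] at hlog
      have := Real.add_one_le_exp (Real.log (((k : ℝ) + 2) / (k + 1)) * α)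
      have h3 := mul_le_mul_of_nonpos_right hlog hα0
      have h4 : 1 / ((k : ℝ) + 1) * α = α / (k + 1) := by ring
      linarith
    rw [hrec]
    have hfac : 0 ≤ 1 + α / ((k : ℝ) + 1) := by
      have : 1 + α / ((k : ℝ) + 1) = (k + 1 + α) / (k + 1) := by field_simp
      rw [this]; positivity
    calc genBinom ((k : ℝ) + α) k * (1 + α / (k + 1))
        ≤ ((k : ℝ) + 1) ^ α * (((k : ℝ) + 2) / (k + 1)) ^ α :=
          mul_le_mul ih hbern hfac (by positivity)
      _ = (((k + 1 : ℕ) : ℝ) + 1) ^ α := by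
          rw [← Real.mul_rpow hk.le (by positivity)]
          congr 1
          push_cast
          field_simp
          ring

lemma genBinom_two_mul_add_lower_bound (a : ℝ) (ha : -2 < a) (ha1 : a ≤ -1) (k : ℕ) :
    (a + 2) / 4 * ((k : ℝ) + 1) ^ (-(1 / 2) : ℝ) ≤
      genBinom (2 * ((k : ℝ) + 1) + a) (k + 1) * (1 / 4) ^ (k + 1) := by
  induction k with
  | zero =>
    have h1 : 0 < Real.Gamma (a + 2) := Real.Gamma_pos_of_pos (by linarith)
    have : genBinom (2 + a) 1 = a + 2 := by
      have h2 := Real.Gamma_add_one (s := a + 2) (by linarith)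
      simp only [genBinom, Nat.cast_one]
      rw [show 2 + a + 1 = a + 2 + 1 by ring, show 2 + a - 1 + 1 = a + 2 by ring, h2,
        show (1 + 1 : ℝ) = 2 by norm_num, Real.Gamma_two]
      field_simp
    simp [this]
    linarith
  | succ k ih =>
    have hk0 : (0 : ℝ) ≤ k := k.cast_nonneg
    set n : ℝ := (k : ℝ) + 2 with hn
    have hna : 0 < n + a := by linarith
    have hn0 : 0 < n := by linarith
    have hrec : genBinom (2 * (((k + 1 : ℕ) : ℝ) + 1) + a) (k + 1 + 1) =
        genBinom (2 * ((k : ℝ) + 1) + a) (k + 1) *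
          ((2 * n + a) * (2 * n + a - 1) / (n * (n + a))) := by
      have h1 := Real.Gamma_pos_of_pos hna
      have h2 := Real.Gamma_pos_of_pos hn0
      have h3 : 0 < 2 * n + a - 1 := by linarith
      unfold genBinom
      push_cast
      rw [show 2 * ((k : ℝ) + 1 + 1) + a + 1 = (2 * n + a - 1) + 1 + 1 by rw [hn]; ring,
        show (k : ℝ) + 1 + 1 + 1 = n + 1 by rw [hn]; ring,
        show 2 * ((k : ℝ) + 1 + 1) + a - (k + 1 + 1) + 1 = n + a + 1 by rw [hn]; ring,
        show 2 * ((k : ℝ) + 1) + a + 1 = 2 * n + a - 1 by rw [hn]; ring,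
        show 2 * ((k : ℝ) + 1) + a - (k + 1) + 1 = n + a by rw [hn]; ring,
        show (k : ℝ) + 1 + 1 = n by rw [hn]; ring,
        Real.Gamma_add_one hn0.ne', Real.Gamma_add_one hna.ne',
        Real.Gamma_add_one (by linarith : 2 * n + a - 1 + 1 ≠ 0), Real.Gamma_add_one h3.ne']
      field_simp
      ring
    have hratio : 1 - 1 / (2 * n) ≤ (2 * n + a) * (2 * n + a - 1) / (n * (n + a)) * (1 / 4) := by
      rw [← sub_nonneg]
      have : (2 * n + a) * (2 * n + a - 1) / (n * (n + a)) * (1 / 4) - (1 - 1 / (2 * n)) =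
          a * (a + 1) / (4 * n * (n + a)) := by field_simp; ring
      rw [this]
      have : 0 ≤ a * (a + 1) := by nlinarith
      positivity
    have hsqrt : n ^ (-(1 / 2) : ℝ) ≤ (n - 1) ^ (-(1 / 2) : ℝ) * (1 - 1 / (2 * n)) := by
      have hn1 : 0 < n - 1 := by linarith
      rw [Real.rpow_neg hn0.le, Real.rpow_neg hn1.le, ← Real.sqrt_eq_rpow, ← Real.sqrt_eq_rpow]
      have h1 := Real.sqrt_pos.mpr hn0
      have h2 := Real.sqrt_pos.mpr hn1
      have h3 := Real.sq_sqrt hn0.le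
      have h4 := Real.sq_sqrt hn1.le
      rw [inv_mul_eq_div, le_div_iff₀ h2, inv_mul_le_iff₀ h1]
      have h5 : 1 - 1 / (2 * n) = (2 * n - 1) / (2 * √n * √n) := by
        rw [show 2 * √n * √n = 2 * n by nlinarith]; field_simp
      rw [h5]
      have h6 : √n * ((2 * n - 1) / (2 * √n * √n)) = (2 * n - 1) / (2 * √n) := by field_simp
      rw [h6, le_div_iff₀ (by positivity)]
      nlinarith [sq_nonneg (√n - √(n - 1))]
    rw [hrec]
    push_cast
    rw [show (k : ℝ) + 1 + 1 = n by rw [hn]; ring]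
    rw [show (k : ℝ) + 1 = n - 1 by rw [hn]; ring] at ih ⊢
    have hfac : 0 ≤ 1 - 1 / (2 * n) := by
      rw [sub_nonneg, div_le_one (by positivity)]; linarith
    have hn1 : 0 < n - 1 := by linarith
    have ha2 : 0 < (a + 2) / 4 := by linarith
    calc (a + 2) / 4 * n ^ (-(1 / 2) : ℝ)
        ≤ (a + 2) / 4 * ((n - 1) ^ (-(1 / 2) : ℝ) * (1 - 1 / (2 * n))) := by gcongr
      _ = ((a + 2) / 4 * (n - 1) ^ (-(1 / 2) : ℝ)) * (1 - 1 / (2 * n)) := by ring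
      _ ≤ _ := mul_le_mul ih hratio hfac (le_trans (by positivity) ih)
      _ = _ := by ring

/-- The integrals of `g` against `cos (kθ)` on `[0, π]` vanish for `k > n`, and the one for `k = n`
is `L π / 2 ^ n`, as for `g = p ∘ cos` with `p` of degree at most `n` and `n`-th coefficient `L`. -/
def HasCosLeadingCoeff (n : ℕ) (L : ℝ) (g : ℝ → ℝ) : Prop :=
  Continuous g ∧
    (∫ θ in (0 : ℝ)..Real.pi, Real.cos (n * θ) * g θ) = L * (Real.pi / 2 ^ n) ∧
    ∀ k : ℕ, n < k → (∫ θ in (0 : ℝ)..Real.pi, Real.cos (k * θ) * g θ) = 0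

lemma hasCosLeadingCoeff_one : HasCosLeadingCoeff 0 1 fun _ => 1 := by
  refine ⟨continuous_const, by simp, fun k hk => ?_⟩
  have hk' : (k : ℝ) ≠ 0 := by exact_mod_cast hk.ne'
  simp [intervalIntegral.integral_comp_mul_left Real.cos hk', Real.sin_nat_mul_pi]

lemma HasCosLeadingCoeff.mul_cos_add_div_two {n : ℕ} {L : ℝ} {g : ℝ → ℝ}
    (h : HasCosLeadingCoeff n L g) (c : ℝ) :
    HasCosLeadingCoeff (n + 1) (L / 2) fun θ => g θ * ((Real.cos θ + c) / 2) := by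
  obtain ⟨hg, hn, h0⟩ := h
  have key : ∀ k : ℕ, (∫ θ in (0 : ℝ)..Real.pi,
      Real.cos ((k + 1 : ℕ) * θ) * (g θ * ((Real.cos θ + c) / 2))) =
      1 / 4 * (∫ θ in (0 : ℝ)..Real.pi, Real.cos ((k + 2 : ℕ) * θ) * g θ) +
      1 / 4 * (∫ θ in (0 : ℝ)..Real.pi, Real.cos (k * θ) * g θ) +
      c / 2 * (∫ θ in (0 : ℝ)..Real.pi, Real.cos ((k + 1 : ℕ) * θ) * g θ) := by
    intro k
    rw [← intervalIntegral.integral_const_mul, ← intervalIntegral.integral_const_mul,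
      ← intervalIntegral.integral_const_mul, ← intervalIntegral.integral_add,
      ← intervalIntegral.integral_add]
    · refine intervalIntegral.integral_congr fun θ _ => ?_
      have h1 : Real.cos ((k + 2 : ℕ) * θ) + Real.cos (k * θ) =
          2 * Real.cos ((k + 1 : ℕ) * θ) * Real.cos θ := by
        rw [show ((k + 2 : ℕ) : ℝ) * θ = (k + 1 : ℕ) * θ + θ by push_cast; ring,
          show (k : ℝ) * θ = (k + 1 : ℕ) * θ - θ by push_cast; ring, Real.cos_add, Real.cos_sub]
        ring
      linear_combination (-(1 / 4) * g θ) * h1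
    all_goals exact Continuous.intervalIntegrable (by fun_prop) _ _
  refine ⟨by fun_prop, ?_, fun k hk => ?_⟩
  · rw [key, hn, h0 _ (by omega), h0 _ (by omega), pow_succ]
    field_simp
    ring
  · obtain ⟨k, rfl⟩ : ∃ j, k = j + 1 := ⟨k - 1, by omega⟩
    rw [key, h0 _ (by omega), h0 _ (by omega), h0 _ (by omega)]
    ring

lemma hasCosLeadingCoeff_pow_mul_pow (s t : ℕ) :
    HasCosLeadingCoeff (s + t) ((1 / 2) ^ (s + t))
      fun θ => ((Real.cos θ - 1) / 2) ^ s * ((Real.cos θ + 1) / 2) ^ t := by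
  induction t with
  | zero =>
    induction s with
    | zero => simpa using hasCosLeadingCoeff_one
    | succ s ih =>
      convert ih.mul_cos_add_div_two (-1) using 1
      · ring
      · funext θ
        ring
  | succ t ih =>
    convert ih.mul_cos_add_div_two 1 using 1
    · ring
    · ring
    · funext θ
      ring

lemma continuous_jacobiP_cos (α β : ℝ) (k : ℕ) :
    Continuous fun θ => jacobiP α β k (Real.cos θ) := by
  unfold jacobiP
  fun_prop

lemma integral_cos_mul_jacobiP_cos (α β : ℝ) (k : ℕ) :
    (∫ θ in (0 : ℝ)..Real.pi, Real.cos (k * θ) * jacobiP α β k (Real.cos θ)) =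
      (∑ s ∈ Finset.range (k + 1),
        genBinom ((k : ℝ) + α) (k - s) * genBinom ((k : ℝ) + β) s) * (Real.pi * (1 / 4) ^ k) := by
  simp_rw [jacobiP, Finset.mul_sum]
  rw [intervalIntegral.integral_finsetSum
    fun s _ => Continuous.intervalIntegrable (by fun_prop) _ _, Finset.sum_mul]
  refine Finset.sum_congr rfl fun s hs => ?_
  have hs' : s + (k - s) = k := by have := Finset.mem_range.mp hs; omega
  have h := (hasCosLeadingCoeff_pow_mul_pow s (k - s)).2.1
  rw [hs'] at h
  rw [show Real.pi * (1 / 4 : ℝ) ^ k = (1 / 2) ^ k * (Real.pi / 2 ^ k) by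
    rw [div_eq_mul_inv Real.pi, ← inv_pow, mul_left_comm, ← mul_pow]; norm_num, ← h,
    ← intervalIntegral.integral_const_mul]
  exact intervalIntegral.integral_congr fun θ _ => by ring

lemma jacobiP_one (α β : ℝ) (hβ : -1 < β) (k : ℕ) :
    jacobiP α β k 1 = genBinom ((k : ℝ) + α) k := by
  have hpos : 0 < (k : ℝ) + β + 1 := by linarith [k.cast_nonneg (α := ℝ)]
  have h1 : genBinom ((k : ℝ) + β) 0 = 1 := by
    rw [genBinom_eq_choose _ _ (by simpa using hpos), Ring.choose_zero_right]
  rw [jacobiP, Finset.sum_eq_single 0]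
  · simp [h1]
  · intro s _ hs
    simp [hs]
  · simp

lemma jacobiWeight_nonneg (α β : ℝ) {θ : ℝ} (hθ : θ ∈ Ioc 0 Real.pi) :
    0 ≤ jacobiWeight α β θ := by
  have h1 : 0 ≤ Real.sin (θ / 2) :=
    Real.sin_nonneg_of_nonneg_of_le_pi (by linarith [hθ.1]) (by linarith [hθ.2, hθ.1])
  have h2 : 0 ≤ Real.cos (θ / 2) :=
    Real.cos_nonneg_of_neg_pi_div_two_le_of_le (by linarith [hθ.1, Real.pi_pos])
      (by linarith [hθ.2])
  unfold jacobiWeight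
  positivity

lemma jacobiWeight_pos (α β : ℝ) {θ : ℝ} (hθ : θ ∈ Ioo 0 Real.pi) :
    0 < jacobiWeight α β θ := by
  have h1 : 0 < Real.sin (θ / 2) :=
    Real.sin_pos_of_pos_of_lt_pi (by linarith [hθ.1]) (by linarith [hθ.2, hθ.1])
  have h2 : 0 < Real.cos (θ / 2) :=
    Real.cos_pos_of_mem_Ioo ⟨by linarith [hθ.1, Real.pi_pos], by linarith [hθ.2]⟩
  unfold jacobiWeight
  positivity

lemma bddAbove_abs_fourierJacobi (α β : ℝ) (k : ℕ) :
    BddAbove {r : ℝ | ∃ f : ℝ → ℝ, MemJacobiL α β f ∧ jacobiNorm α β f ≤ 1 ∧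
      r = |fourierJacobi α β f k|} := by
  obtain ⟨B, hB⟩ := (isCompact_Icc (a := (0 : ℝ)) (b := Real.pi)).exists_bound_of_continuousOn
    ((continuous_jacobiP_cos α β k).div_const (jacobiP α β k 1)).continuousOn
  have hB0 : 0 ≤ B := (norm_nonneg _).trans (hB 0 ⟨le_rfl, Real.pi_pos.le⟩)
  refine ⟨B, ?_⟩
  rintro r ⟨f, hf, hnorm, rfl⟩
  have hint : IntegrableOn (fun θ => |f θ| * jacobiWeight α β θ) (Ioc 0 Real.pi) := by
    refine (integrableOn_congr_fun (fun θ hθ => ?_) measurableSet_Ioc).mp hf.abs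
    simp only [abs_mul, abs_of_nonneg (jacobiWeight_nonneg α β hθ)]
  calc |fourierJacobi α β f k|
      ≤ ∫ θ in Ioc (0 : ℝ) Real.pi, B * (|f θ| * jacobiWeight α β θ) := by
        rw [← Real.norm_eq_abs, fourierJacobi]
        refine norm_integral_le_of_norm_le (hint.const_mul B) ?_
        refine (ae_restrict_iff' measurableSet_Ioc).mpr (.of_forall fun θ hθ => ?_)
        have h1 : |jacobiR α β k (Real.cos θ)| ≤ B := hB θ ⟨hθ.1.le, hθ.2⟩
        have h2 := jacobiWeight_nonneg α β hθ
        rw [Real.norm_eq_abs, abs_mul, abs_mul, abs_of_nonneg h2,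
          show |f θ| * |jacobiR α β k (Real.cos θ)| * jacobiWeight α β θ =
            |jacobiR α β k (Real.cos θ)| * (|f θ| * jacobiWeight α β θ) by ring]
        gcongr
    _ = B * jacobiNorm α β f := integral_const_mul _ _
    _ ≤ B := mul_le_of_le_one_right hB0 hnorm

lemma abs_integral_cos_mul_jacobiR_le (α β : ℝ) (k : ℕ) :
    |∫ θ in (0 : ℝ)..Real.pi, Real.cos (k * θ) * jacobiR α β k (Real.cos θ)| / Real.pi ≤
      jacobiCoeffOpNorm α β k := by
  have hπ := Real.pi_pos
  have hw : ∀ᵐ θ ∂volume.restrict (Ioc (0 : ℝ) Real.pi), 0 < jacobiWeight α β θ := by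
    rw [← Measure.restrict_congr_set (Ioo_ae_eq_Ioc (μ := volume) (a := (0 : ℝ)) (b := Real.pi))]
    exact (ae_restrict_iff' measurableSet_Ioo).mpr (.of_forall fun θ hθ => jacobiWeight_pos α β hθ)
  refine le_csSup (bddAbove_abs_fourierJacobi α β k)
    ⟨fun θ => Real.cos (k * θ) / (Real.pi * jacobiWeight α β θ), ?_, ?_, ?_⟩
  · have hc : IntegrableOn (fun θ : ℝ => Real.cos (k * θ) / Real.pi) (Ioc 0 Real.pi) :=
      (Continuous.integrableOn_Icc (by fun_prop)).mono_set Ioc_subset_Icc_self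
    refine hc.congr ?_
    filter_upwards [hw] with θ hθ
    field_simp
  · have hle : jacobiNorm α β (fun θ => Real.cos (k * θ) / (Real.pi * jacobiWeight α β θ)) ≤
        ∫ θ in Ioc (0 : ℝ) Real.pi, 1 / Real.pi := by
      refine integral_mono_of_nonneg ?_ (by simp) ?_
      · filter_upwards [hw] with θ hθ
        simp only [Pi.zero_apply]
        positivity
      · filter_upwards [hw] with θ hθ
        simp only [abs_div, abs_of_pos (mul_pos hπ hθ)]
        rw [div_mul_eq_mul_div, mul_div_mul_right _ _ hθ.ne']
        gcongr
        exact Real.abs_cos_le_one _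
    refine hle.trans (le_of_eq ?_)
    simp [hπ.le, hπ.ne']
  · rw [intervalIntegral.integral_of_le hπ.le, fourierJacobi, ← abs_of_pos hπ, ← abs_div,
      abs_of_pos hπ, ← integral_div]
    congr 1
    refine integral_congr_ae ?_
    filter_upwards [hw] with θ hθ
    field_simp

lemma choose_div_genBinom_le_jacobiCoeffOpNorm (α β : ℝ) (hα : -1 < α) (hβ : -1 < β) (k : ℕ) :
    Ring.choose (2 * (k : ℝ) + (α + β)) k * (1 / 4) ^ k / genBinom ((k : ℝ) + α) k ≤
      jacobiCoeffOpNorm α β k := by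
  refine le_trans ?_ (abs_integral_cos_mul_jacobiR_le α β k)
  have h : (∫ θ in (0 : ℝ)..Real.pi, Real.cos (k * θ) * jacobiR α β k (Real.cos θ)) =
      Real.pi * (Ring.choose (2 * (k : ℝ) + (α + β)) k * (1 / 4) ^ k /
        genBinom ((k : ℝ) + α) k) := by
    simp_rw [jacobiR, ← mul_div_assoc]
    rw [intervalIntegral.integral_div, integral_cos_mul_jacobiP_cos,
      sum_genBinom_mul_genBinom α β hα hβ, jacobiP_one α β hβ]
    ring
  rw [h, le_div_iff₀ Real.pi_pos, mul_comm]
  exact le_abs_self _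

/-- For `-1 < β ≤ α < -1/2`, the norms of the coefficient functionals
`T_k f = f̂_{(α,β)}(k)` satisfy `‖T_k‖ ≥ C′ (k+1)^{-α-1/2}`. -/
theorem jacobiCoeffOpNorm_lower_bound (α β : ℝ) (hβ : -1 < β) (hβα : β ≤ α)
    (hα : α < -(1/2)) :
    ∃ C' > (0 : ℝ), ∀ k : ℕ,
      C' * ((k : ℝ) + 1) ^ (-α - 1/2) ≤ jacobiCoeffOpNorm α β k := by
  have hα1 : -1 < α := by linarith
  have hC : 0 < (α + β + 2) / 4 := by linarith
  refine ⟨(α + β + 2) / 4, hC, fun k => ?_⟩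
  refine le_trans ?_ (choose_div_genBinom_le_jacobiCoeffOpNorm α β hα1 hβ k)
  have hk : (0 : ℝ) < (k : ℝ) + 1 := by positivity
  have hp : 0 < genBinom ((k : ℝ) + α) k := genBinom_pos _ _ (by linarith)
  have hnum : (α + β + 2) / 4 * ((k : ℝ) + 1) ^ (-(1 / 2) : ℝ) ≤
      Ring.choose (2 * (k : ℝ) + (α + β)) k * (1 / 4) ^ k := by
    cases k with
    | zero => simp; linarith
    | succ k =>
      have h1 := genBinom_two_mul_add_lower_bound (α + β) (by linarith) (by linarith) k
      have hk0 : (0 : ℝ) ≤ k := k.cast_nonneg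
      rw [genBinom_eq_choose _ _ (by push_cast; linarith)] at h1
      push_cast
      refine le_trans ?_ h1
      refine mul_le_mul_of_nonneg_left ?_ hC.le
      exact Real.rpow_le_rpow_of_nonpos (by positivity) (by linarith) (by norm_num)
  rw [le_div_iff₀ hp]
  calc (α + β + 2) / 4 * ((k : ℝ) + 1) ^ (-α - 1 / 2) * genBinom ((k : ℝ) + α) k
      ≤ (α + β + 2) / 4 * ((k : ℝ) + 1) ^ (-α - 1 / 2) * ((k : ℝ) + 1) ^ α := by
        gcongr
        exact genBinom_add_le_rpow α hα1 (by linarith) k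
    _ = (α + β + 2) / 4 * ((k : ℝ) + 1) ^ (-(1 / 2) : ℝ) := by
        rw [mul_assoc, ← Real.rpow_add hk]
        ring_nf
    _ ≤ _ := hnum
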